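/- Fix p21, r21, x22, x32, x33, y22, y32, y33 ∈ F, and for a, b ∈ F set M(a,b) := T₃(q)((0,0,0; p21,x22,0; a,x32,x33), (0,0,0; r21,y22,0; b,y32,y33)) and D(a,b) := T₃(q)((0,0,0; 0,0,0; a,0,0), (0,0,0; 0,0,0; b,0,0)). Assume that for all a, b ∈ F the cyclic submodule M(a,b) is not free and is not contained in any free cyclic submodule of ²T₃(q) generated by a non-unimodular pair. Let the point set be Π := {M(a,b) : a, b ∈ F} ∪ {D(a,b) : (a,b) ∈ F², (a,b) ≠ (0,0)}, and let the line set be 𝕃 := {ℓ : ℓ is a free cyclic submodule of ²T₃(q) containing M(a,b) for some a, b ∈ F} ∪ {N}, where N := T₃(q)((x22,0,0; y22,0,0; 0,δ,0), (y22,0,0; δ,0,0; 0,y22,0)) with δ = 1 if y22 = 0 and δ = 0 otherwise; say a point P ∈ Π lies on a line ℓ ∈ 𝕃 when P ⊆ ℓ. Then (Π, 𝕃) is a projective plane of order q; explicitly: any two distinct points of Π are contained in exactly one line of 𝕃; for any two distinct lines of 𝕃 there is exactly one point of Π contained in both; there exist four points of Π no three of which are contained in one common line; and every line of 𝕃 contains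 exactly q+1 points of Π. -/

import Mathlib

open Matrix

/-- `Mat n F` is the type of `n × n` matrices over `F`. -/
abbrev Mat (n : ℕ) (F : Type) : Type := Matrix (Fin n) (Fin n) F

/-- A matrix is lower triangular (i.e. belongs to the ring `T_n(q)`)
if all entries above the diagonal vanish. -/
def LowerTri {n : ℕ} {F : Type} [Zero F] (X : Mat n F) : Prop :=
  ∀ i j : Fin n, i < j → X i j = 0

/-- The cyclic left submodule `T_n(q)(X,Y)` of `²T_n(q)` generated by the pair `(X,Y)`. -/
def cyc {n : ℕ} {F : Type} [Field F] (X Y : Mat n F) : Set (Mat n F × Mat n F) :=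
  {p | ∃ A : Mat n F, LowerTri A ∧ p = (A * X, A * Y)}

/-- The pair `(X,Y)` generates a *free* cyclic submodule:
`A • (X,Y) = (0,0)` with `A ∈ T_n(q)` forces `A = 0`. -/
def IsFreePair {n : ℕ} {F : Type} [Field F] (X Y : Mat n F) : Prop :=
  ∀ A : Mat n F, LowerTri A → A * X = 0 → A * Y = 0 → A = 0

/-- A pair `(X,Y)` is unimodular if for every index `i` one of the `i`-th
diagonal entries of `X`, `Y` is nonzero. -/
def Unimodular {n : ℕ} {F : Type} [Field F] (X Y : Mat n F) : Prop :=
  ∀ i : Fin n, X i i ≠ 0 ∨ Y i i ≠ 0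

/-- `M` is a free cyclic submodule of `²T_n(q)`. -/
def IsFreeCyc {n : ℕ} {F : Type} [Field F] (M : Set (Mat n F × Mat n F)) : Prop :=
  ∃ X Y : Mat n F, LowerTri X ∧ LowerTri Y ∧ IsFreePair X Y ∧ M = cyc X Y

/-- `M` is a free cyclic submodule of `²T_n(q)` generated by a non-unimodular pair. -/
def IsNonUnimodFreeCyc {n : ℕ} {F : Type} [Field F] (M : Set (Mat n F × Mat n F)) : Prop :=
  ∃ X Y : Mat n F, LowerTri X ∧ LowerTri Y ∧ ¬ Unimodular X Y ∧ IsFreePair X Y ∧ M = cyc X Y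

/-- The point
`M(a,b) = T₃(q)((0,0,0; p21,x22,0; a,x32,x33),(0,0,0; r21,y22,0; b,y32,y33))`. -/
def Mpt3 {F : Type} [Field F] (p21 r21 x22 x32 x33 y22 y32 y33 a b : F) :
    Set (Mat 3 F × Mat 3 F) :=
  cyc !![0, 0, 0; p21, x22, 0; a, x32, x33] !![0, 0, 0; r21, y22, 0; b, y32, y33]

/-- The point at infinity
`D(a,b) = T₃(q)((0,0,0; 0,0,0; a,0,0),(0,0,0; 0,0,0; b,0,0))`. -/
def Dpt3 {F : Type} [Field F] (a b : F) : Set (Mat 3 F × Mat 3 F) :=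
  cyc !![0, 0, 0; 0, 0, 0; a, 0, 0] !![0, 0, 0; 0, 0, 0; b, 0, 0]

/-- The point set `Π` of the projective closure. -/
def PtSet3 {F : Type} [Field F] (p21 r21 x22 x32 x33 y22 y32 y33 : F) :
    Set (Set (Mat 3 F × Mat 3 F)) :=
  {P | ∃ a b : F, P = Mpt3 p21 r21 x22 x32 x33 y22 y32 y33 a b} ∪
  {P | ∃ a b : F, (a, b) ≠ (0, 0) ∧ P = Dpt3 a b}

/-- The line at infinity `N`. -/
def Nline3 {F : Type} [Field F] [DecidableEq F] (x22 y22 : F) :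
    Set (Mat 3 F × Mat 3 F) :=
  cyc !![x22, 0, 0; y22, 0, 0; 0, (if y22 = 0 then 1 else 0), 0]
      !![y22, 0, 0; (if y22 = 0 then 1 else 0), 0, 0; 0, y22, 0]

/-- The line set `𝕃` of the projective closure. -/
def LnSet3 {F : Type} [Field F] [DecidableEq F]
    (p21 r21 x22 x32 x33 y22 y32 y33 : F) : Set (Set (Mat 3 F × Mat 3 F)) :=
  {l | IsFreeCyc l ∧ ∃ a b : F, Mpt3 p21 r21 x22 x32 x33 y22 y32 y33 a b ⊆ l} ∪
  {Nline3 x22 y22}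

theorem matrix_three_eq_iff {F : Type} (A B : Mat 3 F) :
    A = B ↔ (A 0 0 = B 0 0 ∧ A 0 1 = B 0 1 ∧ A 0 2 = B 0 2) ∧
      (A 1 0 = B 1 0 ∧ A 1 1 = B 1 1 ∧ A 1 2 = B 1 2) ∧
      (A 2 0 = B 2 0 ∧ A 2 1 = B 2 1 ∧ A 2 2 = B 2 2) := by
  simp [← Matrix.ext_iff, Fin.forall_fin_succ]

theorem ncard_insert_range {F α : Type*} [Fintype F] {q : ℕ} (hF : Fintype.card F = q)
    {f : F → α} (hf : Function.Injective f) {x : α} (hx : ∀ t, x ≠ f t) :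
    (insert x (Set.range f)).ncard = q + 1 := by
  rw [Set.ncard_insert_of_notMem (by rintro ⟨t, ht⟩; exact hx t ht.symm), ← Set.image_univ,
    Set.ncard_image_of_injective _ hf, Set.ncard_univ, Nat.card_eq_fintype_card, hF]

section Triangular

variable {F : Type} [Field F]

theorem lowerTri_three (a b c d e f : F) : LowerTri !![a, 0, 0; b, c, 0; d, e, f] := by
  intro i j h
  fin_cases i <;> fin_cases j <;> simp_all

theorem LowerTri.eq_three {A : Mat 3 F} (hA : LowerTri A) :
    A = !![A 0 0, 0, 0; A 1 0, A 1 1, 0; A 2 0, A 2 1, A 2 2] := by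
  have h₁ := hA 0 1 (by decide)
  have h₂ := hA 0 2 (by decide)
  have h₃ := hA 1 2 (by decide)
  ext i j
  fin_cases i <;> fin_cases j <;> simp_all

theorem LowerTri.mul {n : ℕ} {A B : Mat n F} (hA : LowerTri A) (hB : LowerTri B) :
    LowerTri (A * B) := by
  intro i j hij
  rw [Matrix.mul_apply]
  refine Finset.sum_eq_zero fun k _ => ?_
  rcases lt_or_ge i k with h | h
  · rw [hA i k h, zero_mul]
  · rw [hB k j (h.trans_lt hij), mul_zero]

theorem lowerTri_one {n : ℕ} : LowerTri (1 : Mat n F) :=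
  fun _ _ h => Matrix.one_apply_ne h.ne

theorem cyc_subset_iff {n : ℕ} {X Y X' Y' : Mat n F} :
    cyc X Y ⊆ cyc X' Y' ↔ ∃ A, LowerTri A ∧ X = A * X' ∧ Y = A * Y' := by
  constructor
  · intro h
    obtain ⟨A, hA, e⟩ := h ⟨1, lowerTri_one, by rw [one_mul, one_mul]⟩
    exact ⟨A, hA, by simpa using e⟩
  · rintro ⟨A, hA, rfl, rfl⟩ _ ⟨B, hB, rfl⟩
    exact ⟨B * A, hB.mul hA, by simp only [Matrix.mul_assoc]⟩

theorem cyc_subset_iff_three {X Y X' Y' : Mat 3 F} :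
    cyc X Y ⊆ cyc X' Y' ↔ ∃ a b c d e f : F,
      X = !![a, 0, 0; b, c, 0; d, e, f] * X' ∧ Y = !![a, 0, 0; b, c, 0; d, e, f] * Y' := by
  rw [cyc_subset_iff]
  constructor
  · rintro ⟨A, hA, h⟩
    exact ⟨_, _, _, _, _, _, hA.eq_three ▸ h⟩
  · rintro ⟨a, b, c, d, e, f, h⟩
    exact ⟨_, lowerTri_three a b c d e f, h⟩

theorem cyc_mul_eq {a c f : F} (b d e : F) (ha : a ≠ 0) (hc : c ≠ 0) (hf : f ≠ 0)
    (X Y : Mat 3 F) :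
    cyc (!![a, 0, 0; b, c, 0; d, e, f] * X) (!![a, 0, 0; b, c, 0; d, e, f] * Y) = cyc X Y := by
  refine Set.Subset.antisymm (cyc_subset_iff.2 ⟨_, lowerTri_three _ _ _ _ _ _, rfl, rfl⟩)
    (cyc_subset_iff.2 ⟨_, lowerTri_three a⁻¹ (-(b / (a * c))) c⁻¹
      ((b * e - c * d) / (a * c * f)) (-(e / (c * f))) f⁻¹, ?_⟩)
  have h : !![a⁻¹, 0, 0; -(b / (a * c)), c⁻¹, 0;
      (b * e - c * d) / (a * c * f), -(e / (c * f)), f⁻¹] *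
      !![a, 0, 0; b, c, 0; d, e, f] = 1 := by
    ext i j
    fin_cases i <;> fin_cases j <;>
      simp [Matrix.mul_apply, Fin.sum_univ_three, ha, hc, hf] <;> field_simp <;> ring
  simp only [← Matrix.mul_assoc, h, one_mul, and_self]

theorem exists_mul_eq_of_cross {u v c d : F} (h : u ≠ 0 ∨ v ≠ 0) (e : c * v = d * u) :
    ∃ k, c = k * u ∧ d = k * v := by
  rcases h with h | h
  · exact ⟨c / u, by field_simp, by field_simp; rw [e]⟩
  · exact ⟨d / v, by field_simp; rw [e], by field_simp⟩

theorem pair_ne_zero_iff {a b : F} : (a, b) ≠ (0, 0) ↔ a ≠ 0 ∨ b ≠ 0 := by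
  simp [Prod.ext_iff, imp_iff_not_or]

end Triangular

/-- The free cyclic submodule joining the points `M(a + t u, b + t v)` and `D(u,v)`. -/
def Lline3 {F : Type} [Field F] (p21 r21 x22 x32 x33 y22 y32 y33 u v a b : F) :
    Set (Mat 3 F × Mat 3 F) :=
  cyc !![u, 0, 0; p21, x22, 0; a, x32, x33] !![v, 0, 0; r21, y22, 0; b, y32, y33]

section Incidence

variable {F : Type} [Field F] {p21 r21 x22 x32 x33 y22 y32 y33 u v a b c d : F}

local notation "𝐌" => Mpt3 p21 r21 x22 x32 x33 y22 y32 y33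
local notation "𝐋" => Lline3 p21 r21 x22 x32 x33 y22 y32 y33

theorem Mpt3_subset_Lline3_iff (h2 : x22 ≠ 0 ∨ y22 ≠ 0) (h3 : x33 ≠ 0 ∨ y33 ≠ 0)
    (huv : u ≠ 0 ∨ v ≠ 0) : 𝐌 c d ⊆ 𝐋 u v a b ↔ (c - a) * v = (d - b) * u := by
  rw [Mpt3, Lline3, cyc_subset_iff_three]
  simp only [matrix_three_eq_iff]
  simp [Matrix.mul_apply, Fin.sum_univ_three]
  constructor
  · rintro ⟨-, -, -, s, e, f, ⟨-, -, hX0, hX1, hX2⟩, -, -, hY0, hY1, hY2⟩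
    have hf : f = 1 := by grind
    have he : e = 0 := by grind
    subst hf he
    grind
  · intro h
    obtain ⟨k, h₁, h₂⟩ := exists_mul_eq_of_cross huv h
    refine ⟨0, 0, 1, k, 0, 1, ?_⟩
    grind

theorem Dpt3_subset_Lline3_iff (h2 : x22 ≠ 0 ∨ y22 ≠ 0) (h3 : x33 ≠ 0 ∨ y33 ≠ 0)
    (huv : u ≠ 0 ∨ v ≠ 0) : Dpt3 c d ⊆ 𝐋 u v a b ↔ c * v = d * u := by
  rw [Dpt3, Lline3, cyc_subset_iff_three]
  simp only [matrix_three_eq_iff]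
  simp [Matrix.mul_apply, Fin.sum_univ_three]
  constructor
  · rintro ⟨-, -, -, s, e, f, ⟨-, -, hX0, hX1, hX2⟩, -, -, hY0, hY1, hY2⟩
    have hf : f = 0 := by grind
    have he : e = 0 := by grind
    subst hf he
    grind
  · intro h
    obtain ⟨k, h₁, h₂⟩ := exists_mul_eq_of_cross huv h
    refine ⟨0, 0, 0, k, 0, 0, ?_⟩
    grind

theorem Dpt3_eq_iff (hab : a ≠ 0 ∨ b ≠ 0) (hcd : c ≠ 0 ∨ d ≠ 0) :
    Dpt3 a b = Dpt3 c d ↔ a * d = b * c := by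
  constructor
  · intro h
    have := h.le
    rw [Dpt3, Dpt3, cyc_subset_iff_three] at this
    simp only [matrix_three_eq_iff] at this
    simp [Matrix.mul_apply, Fin.sum_univ_three] at this
    grind
  · intro h
    obtain ⟨k, rfl, rfl⟩ := exists_mul_eq_of_cross hcd h
    have hk : k ≠ 0 := by grind
    rw [Dpt3, Dpt3, ← cyc_mul_eq 0 0 0 one_ne_zero one_ne_zero hk !![0, 0, 0; 0, 0, 0; c, 0, 0]]
    congr 1 <;> simp

theorem Mpt3_subset_iff (h2 : x22 ≠ 0 ∨ y22 ≠ 0) (h3 : x33 ≠ 0 ∨ y33 ≠ 0) :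
    𝐌 a b ⊆ 𝐌 c d ↔ a = c ∧ b = d := by
  constructor
  · intro h
    rw [Mpt3, Mpt3, cyc_subset_iff_three] at h
    simp only [matrix_three_eq_iff] at h
    simp [Matrix.mul_apply, Fin.sum_univ_three] at h
    obtain ⟨-, e, f, ⟨-, hX0, hX1, hX2⟩, -, hY0, hY1, hY2⟩ := h
    have hf : f = 1 := by grind
    have he : e = 0 := by grind
    subst hf he
    grind
  · rintro ⟨rfl, rfl⟩
    rfl

theorem Mpt3_not_subset_Dpt3 (h2 : x22 ≠ 0 ∨ y22 ≠ 0) : ¬ 𝐌 a b ⊆ Dpt3 c d := by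
  rw [Mpt3, Dpt3, cyc_subset_iff_three]
  simp only [matrix_three_eq_iff]
  simp [Matrix.mul_apply, Fin.sum_univ_three]
  grind

theorem Mpt3_not_subset_Nline3 [DecidableEq F] (h2 : x22 ≠ 0 ∨ y22 ≠ 0) :
    ¬ 𝐌 a b ⊆ Nline3 x22 y22 := by
  rw [Mpt3, Nline3, cyc_subset_iff_three]
  simp only [matrix_three_eq_iff]
  simp [Matrix.mul_apply, Fin.sum_univ_three]
  grind

theorem Dpt3_subset_Nline3 [DecidableEq F] (h2 : x22 ≠ 0 ∨ y22 ≠ 0) :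
    Dpt3 c d ⊆ Nline3 x22 y22 := by
  rw [Dpt3, Nline3, cyc_subset_iff_three]
  simp only [matrix_three_eq_iff]
  simp [Matrix.mul_apply, Fin.sum_univ_three]
  refine ⟨0, 0, 0, ?_⟩
  by_cases hy : y22 = 0
  · have hx : x22 ≠ 0 := by tauto
    refine ⟨c / x22, d, 0, ?_⟩
    simp [hy, hx]
  · refine ⟨d / y22, (c - d / y22 * x22) / y22, 0, ?_⟩
    simp [hy]

theorem Lline3_congr (huv : u ≠ 0 ∨ v ≠ 0) (hcd : c ≠ 0 ∨ d ≠ 0) (h : c * v = d * u) :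
    𝐋 u v a b = 𝐋 c d a b := by
  obtain ⟨k, rfl, rfl⟩ := exists_mul_eq_of_cross huv h
  have hk : k ≠ 0 := by grind
  rw [Lline3, Lline3, ← cyc_mul_eq 0 0 0 hk one_ne_zero one_ne_zero !![u, 0, 0; _, _, _; _, _, _]]
  congr 1 <;> simp

theorem isFreePair_of_rows {p r x s t y z w : F} (hu : u ≠ 0 ∨ v ≠ 0) (h2 : x ≠ 0 ∨ y ≠ 0)
    (h3 : z ≠ 0 ∨ w ≠ 0) :
    IsFreePair !![u, 0, 0; p, x, 0; a, s, z] !![v, 0, 0; r, y, 0; b, t, w] := by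
  intro A hA hX hY
  rw [hA.eq_three] at hX hY ⊢
  generalize A 0 0 = a00, A 1 0 = a10, A 1 1 = a11, A 2 0 = a20, A 2 1 = a21, A 2 2 = a22 at *
  rw [matrix_three_eq_iff] at hX hY ⊢
  simp [Matrix.mul_apply, Fin.sum_univ_three] at hX hY ⊢
  have : a22 = 0 := by grind
  have : a21 = 0 := by grind
  have : a11 = 0 := by grind
  grind

theorem isFreeCyc_Lline3 (h2 : x22 ≠ 0 ∨ y22 ≠ 0) (h3 : x33 ≠ 0 ∨ y33 ≠ 0)
    (huv : u ≠ 0 ∨ v ≠ 0) : IsFreeCyc (𝐋 u v a b) :=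
  ⟨_, _, lowerTri_three _ _ _ _ _ _, lowerTri_three _ _ _ _ _ _, isFreePair_of_rows huv h2 h3, rfl⟩

theorem IsFreePair.first_row_ne_zero {X Y : Mat 3 F} (hX : LowerTri X) (hY : LowerTri Y)
    (h : IsFreePair X Y) : X 0 0 ≠ 0 ∨ Y 0 0 ≠ 0 := by
  by_contra! h0
  have := h !![1, 0, 0; 0, 0, 0; 0, 0, 0] (lowerTri_three _ _ _ _ _ _)
    (by rw [hX.eq_three, matrix_three_eq_iff]; simp [h0])
    (by rw [hY.eq_three, matrix_three_eq_iff]; simp [h0])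
  simpa using congrFun (congrFun this 0) 0

theorem IsFreeCyc.eq_Lline3 (h2 : x22 ≠ 0 ∨ y22 ≠ 0) (h3 : x33 ≠ 0 ∨ y33 ≠ 0)
    {l : Set (Mat 3 F × Mat 3 F)} (hl : IsFreeCyc l) (h : 𝐌 a b ⊆ l) :
    ∃ u v, (u ≠ 0 ∨ v ≠ 0) ∧ l = 𝐋 u v a b := by
  obtain ⟨X, Y, hX, hY, hfree, rfl⟩ := hl
  refine ⟨X 0 0, Y 0 0, hfree.first_row_ne_zero hX hY, ?_⟩
  rw [Mpt3, cyc_subset_iff_three] at h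
  obtain ⟨r, s, t, e, f, g, hXe, hYe⟩ := h
  rw [hX.eq_three, matrix_three_eq_iff] at hXe
  rw [hY.eq_three, matrix_three_eq_iff] at hYe
  simp [Matrix.mul_apply, Fin.sum_univ_three] at hXe hYe
  have ht : t ≠ 0 := by grind
  have hg : g ≠ 0 := by grind
  rw [← cyc_mul_eq s e f one_ne_zero ht hg X Y, Lline3]
  congr 1
  · nth_rw 1 [hX.eq_three]
    rw [matrix_three_eq_iff]
    simp [Matrix.mul_apply, Fin.sum_univ_three]
    grind
  · nth_rw 1 [hY.eq_three]
    rw [matrix_three_eq_iff]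
    simp [Matrix.mul_apply, Fin.sum_univ_three]
    grind

theorem exists_isNonUnimodFreeCyc_of_second (hx : x22 = 0) (hy : y22 = 0) :
    ∃ N, IsNonUnimodFreeCyc N ∧ 𝐌 a b ⊆ N := by
  subst hx hy
  by_cases h : x32 = 0 ∧ x33 = 0 ∧ y32 = 0 ∧ y33 = 0
  · refine ⟨_, ⟨!![1, 0, 0; 0, 0, 0; 0, 1, 0], !![0, 0, 0; 1, 0, 0; 0, 0, 0],
      lowerTri_three _ _ _ _ _ _, lowerTri_three _ _ _ _ _ _, fun h => by simpa using h 1, ?_, rfl⟩, ?_⟩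
    · intro A hA hX hY
      rw [hA.eq_three] at hX hY ⊢
      rw [matrix_three_eq_iff] at hX hY ⊢
      simp [Matrix.mul_apply, Fin.sum_univ_three] at hX hY ⊢
      grind
    · rw [Mpt3, cyc_subset_iff_three]
      refine ⟨0, p21, r21, a, b, 0, ?_⟩
      simp [h]
  · refine ⟨_, ⟨!![1, 0, 0; 0, 0, 0; 0, x32, x33], !![0, 0, 0; 1, 0, 0; 0, y32, y33],
      lowerTri_three _ _ _ _ _ _, lowerTri_three _ _ _ _ _ _, fun h => by simpa using h 1, ?_, rfl⟩, ?_⟩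
    · intro A hA hX hY
      rw [hA.eq_three] at hX hY ⊢
      rw [matrix_three_eq_iff] at hX hY ⊢
      simp [Matrix.mul_apply, Fin.sum_univ_three] at hX hY ⊢
      grind
    · rw [Mpt3, cyc_subset_iff_three]
      refine ⟨0, p21, r21, a, b, 1, ?_⟩
      simp

theorem exists_isNonUnimodFreeCyc_of_third (h2 : x22 ≠ 0 ∨ y22 ≠ 0) (hx : x33 = 0)
    (hy : y33 = 0) : ∃ N, IsNonUnimodFreeCyc N ∧ 𝐌 a b ⊆ N := by
  subst hx hy
  by_cases h : x32 * y22 = y32 * x22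
  · obtain ⟨k, rfl, rfl⟩ := exists_mul_eq_of_cross h2 h
    refine ⟨_, ⟨!![1, 0, 0; p21, x22, 0; 0, 0, 0], !![0, 0, 0; r21, y22, 0; 1, 0, 0],
      lowerTri_three _ _ _ _ _ _, lowerTri_three _ _ _ _ _ _, fun h => by simpa using h 2, ?_, rfl⟩, ?_⟩
    · intro A hA hX hY
      rw [hA.eq_three] at hX hY ⊢
      rw [matrix_three_eq_iff] at hX hY ⊢
      simp [Matrix.mul_apply, Fin.sum_univ_three] at hX hY ⊢
      grind
    · rw [Mpt3, cyc_subset_iff_three]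
      refine ⟨0, 0, 1, a - k * p21, k, b - k * r21, ?_⟩
      simp
  · refine ⟨_, ⟨!![1, 0, 0; p21, x22, 0; a, x32, 0], !![0, 0, 0; r21, y22, 0; b, y32, 0],
      lowerTri_three _ _ _ _ _ _, lowerTri_three _ _ _ _ _ _, fun h => by simpa using h 2, ?_, rfl⟩, ?_⟩
    · intro A hA hX hY
      rw [hA.eq_three] at hX hY ⊢
      generalize A 0 0 = a00, A 1 0 = a10, A 1 1 = a11, A 2 0 = a20, A 2 1 = a21,
        A 2 2 = a22 at *
      rw [matrix_three_eq_iff] at hX hY ⊢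
      simp [Matrix.mul_apply, Fin.sum_univ_three] at hX hY ⊢
      have h22 : a22 * (x32 * y22 - y32 * x22) = 0 := by grind
      have : a22 = 0 := by grind
      have : a21 = 0 := by grind
      have : a11 = 0 := by grind
      grind
    · rw [Mpt3, cyc_subset_iff_three]
      refine ⟨0, 0, 1, 0, 0, 1, ?_⟩
      simp

end Incidence

section Plane

variable {F : Type} [Field F] {p21 r21 x22 x32 x33 y22 y32 y33 : F}

local notation "𝐌" => Mpt3 p21 r21 x22 x32 x33 y22 y32 y33
local notation "𝐋" => Lline3 p21 r21 x22 x32 x33 y22 y32 y33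
local notation "𝐏" => PtSet3 p21 r21 x22 x32 x33 y22 y32 y33
local notation "𝐒" => LnSet3 p21 r21 x22 x32 x33 y22 y32 y33

theorem mem_PtSet3_iff {P : Set (Mat 3 F × Mat 3 F)} :
    P ∈ 𝐏 ↔ (∃ a b, P = 𝐌 a b) ∨ ∃ c d, (c ≠ 0 ∨ d ≠ 0) ∧ P = Dpt3 c d := by
  simp only [PtSet3, pair_ne_zero_iff, Set.mem_union, Set.mem_ofPred_eq]

variable [DecidableEq F]

theorem Lline3_mem_LnSet3 (h2 : x22 ≠ 0 ∨ y22 ≠ 0) (h3 : x33 ≠ 0 ∨ y33 ≠ 0)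
    {u v : F} (huv : u ≠ 0 ∨ v ≠ 0) (a b : F) : 𝐋 u v a b ∈ 𝐒 :=
  Or.inl ⟨isFreeCyc_Lline3 h2 h3 huv, a, b, (Mpt3_subset_Lline3_iff h2 h3 huv).2 (by ring)⟩

theorem Nline3_mem_LnSet3 : Nline3 x22 y22 ∈ 𝐒 := Or.inr rfl

theorem eq_Lline3_or_Nline3 (h2 : x22 ≠ 0 ∨ y22 ≠ 0) (h3 : x33 ≠ 0 ∨ y33 ≠ 0)
    {l : Set (Mat 3 F × Mat 3 F)} (hl : l ∈ 𝐒) :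
    (∃ u v a b, (u ≠ 0 ∨ v ≠ 0) ∧ l = 𝐋 u v a b) ∨ l = Nline3 x22 y22 := by
  rcases hl with ⟨hl, a, b, h⟩ | rfl
  · obtain ⟨u, v, huv, rfl⟩ := hl.eq_Lline3 h2 h3 h
    exact Or.inl ⟨u, v, a, b, huv, rfl⟩
  · exact Or.inr rfl

theorem eq_Lline3_of_Mpt3_subset (h2 : x22 ≠ 0 ∨ y22 ≠ 0) (h3 : x33 ≠ 0 ∨ y33 ≠ 0)
    {l : Set (Mat 3 F × Mat 3 F)} (hl : l ∈ 𝐒) {a b : F} (h : 𝐌 a b ⊆ l) :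
    ∃ u v, (u ≠ 0 ∨ v ≠ 0) ∧ l = 𝐋 u v a b := by
  rcases hl with ⟨hl, -⟩ | rfl
  · exact hl.eq_Lline3 h2 h3 h
  · exact absurd h (Mpt3_not_subset_Nline3 h2)

theorem existsUnique_line_Mpt3_Dpt3 (h2 : x22 ≠ 0 ∨ y22 ≠ 0) (h3 : x33 ≠ 0 ∨ y33 ≠ 0)
    (a b : F) {c d : F} (hcd : c ≠ 0 ∨ d ≠ 0) :
    ∃! l, l ∈ 𝐒 ∧ 𝐌 a b ⊆ l ∧ Dpt3 c d ⊆ l := by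
  refine ⟨𝐋 c d a b, ⟨Lline3_mem_LnSet3 h2 h3 hcd a b,
    (Mpt3_subset_Lline3_iff h2 h3 hcd).2 (by ring),
    (Dpt3_subset_Lline3_iff h2 h3 hcd).2 (by ring)⟩, ?_⟩
  rintro l ⟨hl, hM, hD⟩
  obtain ⟨u, v, huv, rfl⟩ := eq_Lline3_of_Mpt3_subset h2 h3 hl hM
  exact Lline3_congr huv hcd ((Dpt3_subset_Lline3_iff h2 h3 huv).1 hD)

theorem existsUnique_line (h2 : x22 ≠ 0 ∨ y22 ≠ 0) (h3 : x33 ≠ 0 ∨ y33 ≠ 0)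
    {P Q : Set (Mat 3 F × Mat 3 F)} (hP : P ∈ 𝐏) (hQ : Q ∈ 𝐏) (hPQ : P ≠ Q) :
    ∃! l, l ∈ 𝐒 ∧ P ⊆ l ∧ Q ⊆ l := by
  rw [mem_PtSet3_iff] at hP hQ
  rcases hP with ⟨a, b, rfl⟩ | ⟨a, b, hab, rfl⟩ <;> rcases hQ with ⟨c, d, rfl⟩ | ⟨c, d, hcd, rfl⟩
  · have hne : c - a ≠ 0 ∨ d - b ≠ 0 := by
      by_contra! h
      exact hPQ (by rw [sub_eq_zero.1 h.1, sub_eq_zero.1 h.2])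
    refine ⟨𝐋 (c - a) (d - b) a b, ⟨Lline3_mem_LnSet3 h2 h3 hne a b,
      (Mpt3_subset_Lline3_iff h2 h3 hne).2 (by ring),
      (Mpt3_subset_Lline3_iff h2 h3 hne).2 (by ring)⟩, ?_⟩
    rintro l ⟨hl, hM, hM'⟩
    obtain ⟨u, v, huv, rfl⟩ := eq_Lline3_of_Mpt3_subset h2 h3 hl hM
    exact Lline3_congr huv hne ((Mpt3_subset_Lline3_iff h2 h3 huv).1 hM')
  · exact existsUnique_line_Mpt3_Dpt3 h2 h3 a b hcd
  · simpa only [and_comm (a := Dpt3 a b ⊆ _)] using existsUnique_line_Mpt3_Dpt3 h2 h3 c d hab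
  · refine ⟨Nline3 x22 y22, ⟨Nline3_mem_LnSet3, Dpt3_subset_Nline3 h2, Dpt3_subset_Nline3 h2⟩, ?_⟩
    rintro l ⟨hl, hD, hD'⟩
    rcases eq_Lline3_or_Nline3 h2 h3 hl with ⟨u, v, s, t, huv, rfl⟩ | rfl
    · rw [Dpt3_subset_Lline3_iff h2 h3 huv] at hD hD'
      refine absurd ((Dpt3_eq_iff hab hcd).2 ?_) hPQ
      grind
    · rfl

theorem exists_point (h2 : x22 ≠ 0 ∨ y22 ≠ 0) (h3 : x33 ≠ 0 ∨ y33 ≠ 0)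
    {l m : Set (Mat 3 F × Mat 3 F)} (hl : l ∈ 𝐒) (hm : m ∈ 𝐒) :
    ∃ P ∈ 𝐏, P ⊆ l ∧ P ⊆ m := by
  simp only [mem_PtSet3_iff]
  rcases eq_Lline3_or_Nline3 h2 h3 hl with ⟨u, v, a, b, huv, rfl⟩ | rfl <;>
    rcases eq_Lline3_or_Nline3 h2 h3 hm with ⟨w, z, c, d, hwz, rfl⟩ | rfl
  · by_cases h : u * z = v * w
    · exact ⟨_, Or.inr ⟨u, v, huv, rfl⟩, (Dpt3_subset_Lline3_iff h2 h3 huv).2 (by ring),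
        (Dpt3_subset_Lline3_iff h2 h3 hwz).2 h⟩
    · have h' : u * z - v * w ≠ 0 := sub_ne_zero.2 h
      set t := ((c - a) * z - (d - b) * w) / (u * z - v * w) with ht
      have e : t * (u * z - v * w) = (c - a) * z - (d - b) * w := div_mul_cancel₀ _ h'
      refine ⟨_, Or.inl ⟨a + t * u, b + t * v, rfl⟩,
        (Mpt3_subset_Lline3_iff h2 h3 huv).2 (by ring),
        (Mpt3_subset_Lline3_iff h2 h3 hwz).2 (by linear_combination e)⟩
  · exact ⟨_, Or.inr ⟨u, v, huv, rfl⟩, (Dpt3_subset_Lline3_iff h2 h3 huv).2 (by ring),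
      Dpt3_subset_Nline3 h2⟩
  · exact ⟨_, Or.inr ⟨w, z, hwz, rfl⟩, Dpt3_subset_Nline3 h2,
      (Dpt3_subset_Lline3_iff h2 h3 hwz).2 (by ring)⟩
  · exact ⟨_, Or.inr ⟨1, 0, Or.inl one_ne_zero, rfl⟩, Dpt3_subset_Nline3 h2,
      Dpt3_subset_Nline3 h2⟩

theorem not_collinear (h2 : x22 ≠ 0 ∨ y22 ≠ 0) (h3 : x33 ≠ 0 ∨ y33 ≠ 0)
    {l : Set (Mat 3 F × Mat 3 F)} (hl : l ∈ 𝐒) {a b c d e f : F}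
    (h : (c - a) * (f - b) ≠ (d - b) * (e - a)) :
    ¬ (𝐌 a b ⊆ l ∧ 𝐌 c d ⊆ l ∧ 𝐌 e f ⊆ l) := by
  rintro ⟨h₁, h₂, h₃⟩
  obtain ⟨u, v, huv, rfl⟩ := eq_Lline3_of_Mpt3_subset h2 h3 hl h₁
  rw [Mpt3_subset_Lline3_iff h2 h3 huv] at h₂ h₃
  grind

theorem ncard_points (h2 : x22 ≠ 0 ∨ y22 ≠ 0) (h3 : x33 ≠ 0 ∨ y33 ≠ 0) [Fintype F] {q : ℕ}
    (hF : Fintype.card F = q) {l : Set (Mat 3 F × Mat 3 F)} (hl : l ∈ 𝐒) :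
    {P ∈ 𝐏 | P ⊆ l}.ncard = q + 1 := by
  simp only [mem_PtSet3_iff]
  rcases eq_Lline3_or_Nline3 h2 h3 hl with ⟨u, v, a, b, huv, rfl⟩ | rfl
  · rw [← ncard_insert_range hF (f := fun t => 𝐌 (a + t * u) (b + t * v)) (x := Dpt3 u v)]
    · congr 1
      ext P
      simp only [Set.mem_ofPred_eq, Set.mem_insert_iff, Set.mem_range]
      constructor
      · rintro ⟨⟨c, d, rfl⟩ | ⟨c, d, hcd, rfl⟩, h⟩
        · obtain ⟨k, h₁, h₂⟩ :=
            exists_mul_eq_of_cross huv ((Mpt3_subset_Lline3_iff h2 h3 huv).1 h)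
          exact Or.inr ⟨k, by rw [← h₁, ← h₂, add_sub_cancel, add_sub_cancel]⟩
        · exact Or.inl ((Dpt3_eq_iff hcd huv).2 ((Dpt3_subset_Lline3_iff h2 h3 huv).1 h))
      · rintro (rfl | ⟨t, rfl⟩)
        · exact ⟨Or.inr ⟨u, v, huv, rfl⟩, (Dpt3_subset_Lline3_iff h2 h3 huv).2 (by ring)⟩
        · exact ⟨Or.inl ⟨_, _, rfl⟩, (Mpt3_subset_Lline3_iff h2 h3 huv).2 (by ring)⟩
    · intro s t h
      have := (Mpt3_subset_iff h2 h3).1 h.le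
      grind
    · exact fun t h => Mpt3_not_subset_Dpt3 h2 h.ge
  · rw [← ncard_insert_range hF (f := fun t : F => Dpt3 1 t) (x := Dpt3 0 1)]
    · congr 1
      ext P
      simp only [Set.mem_ofPred_eq, Set.mem_insert_iff, Set.mem_range]
      constructor
      · rintro ⟨⟨c, d, rfl⟩ | ⟨c, d, hcd, rfl⟩, h⟩
        · exact absurd h (Mpt3_not_subset_Nline3 h2)
        · by_cases hc : c = 0
          · exact Or.inl ((Dpt3_eq_iff hcd (by simp)).2 (by simp [hc]))
          · exact Or.inr ⟨d / c, (Dpt3_eq_iff (by simp) hcd).2 (by field_simp)⟩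
      · rintro (rfl | ⟨t, rfl⟩)
        · exact ⟨Or.inr ⟨0, 1, by simp, rfl⟩, Dpt3_subset_Nline3 h2⟩
        · exact ⟨Or.inr ⟨1, t, by simp, rfl⟩, Dpt3_subset_Nline3 h2⟩
    · intro s t h
      simpa using ((Dpt3_eq_iff (by simp) (by simp)).1 h).symm
    · intro t h
      simpa using (Dpt3_eq_iff (by simp) (by simp)).1 h

end Plane

theorem stmt_18 (q : ℕ) (hq : 2 ≤ q)
    (F : Type) [Field F] [Fintype F] [DecidableEq F] (hF : Fintype.card F = q)
    (p21 r21 x22 x32 x33 y22 y32 y33 : F)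
    (hass : ∀ a b : F,
      ¬ IsFreeCyc (Mpt3 p21 r21 x22 x32 x33 y22 y32 y33 a b) ∧
      ∀ N : Set (Mat 3 F × Mat 3 F), IsNonUnimodFreeCyc N →
        ¬ Mpt3 p21 r21 x22 x32 x33 y22 y32 y33 a b ⊆ N) :
    -- two distinct points lie on a unique line
    (∀ P ∈ PtSet3 p21 r21 x22 x32 x33 y22 y32 y33,
      ∀ Q ∈ PtSet3 p21 r21 x22 x32 x33 y22 y32 y33, P ≠ Q →
      ∃! l : Set (Mat 3 F × Mat 3 F),
        l ∈ LnSet3 p21 r21 x22 x32 x33 y22 y32 y33 ∧ P ⊆ l ∧ Q ⊆ l) ∧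
    -- two distinct lines meet in a unique point
    (∀ l ∈ LnSet3 p21 r21 x22 x32 x33 y22 y32 y33,
      ∀ m ∈ LnSet3 p21 r21 x22 x32 x33 y22 y32 y33, l ≠ m →
      ∃! P : Set (Mat 3 F × Mat 3 F),
        P ∈ PtSet3 p21 r21 x22 x32 x33 y22 y32 y33 ∧ P ⊆ l ∧ P ⊆ m) ∧
    -- there are four points no three of which are collinear
    (∃ P₁ P₂ P₃ P₄ : Set (Mat 3 F × Mat 3 F),
      P₁ ∈ PtSet3 p21 r21 x22 x32 x33 y22 y32 y33 ∧
      P₂ ∈ PtSet3 p21 r21 x22 x32 x33 y22 y32 y33 ∧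
      P₃ ∈ PtSet3 p21 r21 x22 x32 x33 y22 y32 y33 ∧
      P₄ ∈ PtSet3 p21 r21 x22 x32 x33 y22 y32 y33 ∧
      P₁ ≠ P₂ ∧ P₁ ≠ P₃ ∧ P₁ ≠ P₄ ∧ P₂ ≠ P₃ ∧ P₂ ≠ P₄ ∧ P₃ ≠ P₄ ∧
      ∀ l ∈ LnSet3 p21 r21 x22 x32 x33 y22 y32 y33,
        ¬ (P₁ ⊆ l ∧ P₂ ⊆ l ∧ P₃ ⊆ l) ∧ ¬ (P₁ ⊆ l ∧ P₂ ⊆ l ∧ P₄ ⊆ l) ∧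
        ¬ (P₁ ⊆ l ∧ P₃ ⊆ l ∧ P₄ ⊆ l) ∧ ¬ (P₂ ⊆ l ∧ P₃ ⊆ l ∧ P₄ ⊆ l)) ∧
    -- every line carries exactly q+1 points
    (∀ l ∈ LnSet3 p21 r21 x22 x32 x33 y22 y32 y33,
      Set.ncard {P ∈ PtSet3 p21 r21 x22 x32 x33 y22 y32 y33 | P ⊆ l} = q + 1) := by
  have h2 : x22 ≠ 0 ∨ y22 ≠ 0 := by
    by_contra! h
    obtain ⟨N, hN, hM⟩ := exists_isNonUnimodFreeCyc_of_second h.1 h.2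
    exact (hass 0 0).2 N hN hM
  have h3 : x33 ≠ 0 ∨ y33 ≠ 0 := by
    by_contra! h
    obtain ⟨N, hN, hM⟩ := exists_isNonUnimodFreeCyc_of_third h2 h.1 h.2
    exact (hass 0 0).2 N hN hM
  have hne {a b c d : F} (h : ¬ (a = c ∧ b = d)) :
      Mpt3 p21 r21 x22 x32 x33 y22 y32 y33 a b ≠ Mpt3 p21 r21 x22 x32 x33 y22 y32 y33 c d :=
    fun e => h ((Mpt3_subset_iff h2 h3).1 e.le)
  refine ⟨fun P hP Q hQ => existsUnique_line h2 h3 hP hQ, fun l hl m hm hlm => ?_, ?_,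
    fun l hl => ncard_points h2 h3 hF hl⟩
  · obtain ⟨P, hP, hPl, hPm⟩ := exists_point h2 h3 hl hm
    refine ⟨P, ⟨hP, hPl, hPm⟩, ?_⟩
    rintro Q ⟨hQ, hQl, hQm⟩
    by_contra hPQ
    exact hlm ((existsUnique_line h2 h3 hQ hP hPQ).unique ⟨hl, hQl, hPl⟩ ⟨hm, hQm, hPm⟩)
  · refine ⟨_, _, _, _, Or.inl ⟨0, 0, rfl⟩, Or.inl ⟨1, 0, rfl⟩, Or.inl ⟨0, 1, rfl⟩,
      Or.inl ⟨1, 1, rfl⟩, hne (by simp), hne (by simp), hne (by simp), hne (by simp),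
      hne (by simp), hne (by simp), fun l hl => ⟨not_collinear h2 h3 hl (by simp),
      not_collinear h2 h3 hl (by simp), not_collinear h2 h3 hl (by simp),
      not_collinear h2 h3 hl (by simp)⟩⟩
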